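/- arXiv:2009.07533 — 5 statements merged into one kernel-verified Lean document; each statement's English description precedes it below -/
import Mathlib

section
/- Let n ≥ 2 and let A be a thick subset of N = {1, …, n}. Then ⌊(n+1)/2⌋ ≤ |A| ≤ n − 1. Moreover, if n is even, then the only thick subsets of cardinality n/2 are A_od = {1, 3, …, n−1} and A_ev = {2, 4, …, n}. -/
/-- The number of blocks (= number of gaps) `b(A)` of a subset `A` of the cyclic set
`N = {1, …, n}`, modelled as `ℤ/nℤ` (so that `n` is followed by `1`): it equals the number
of block beginnings, i.e. of elements `k ∈ A` with `k - 1 ∉ A`. -/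
def blockCount (n : ℕ) (A : Finset (ZMod n)) : ℕ :=
  (A.filter fun k => k - 1 ∉ A).card

/-- `A` is a thick subset of the cyclic set `N = ℤ/nℤ`: `∅ ≠ A ⊊ N` and
`b(A) = n - |A|`, equivalently every gap of `A` is a singleton. -/
def IsThick (n : ℕ) [NeZero n] (A : Finset (ZMod n)) : Prop :=
  A.Nonempty ∧ A ≠ Finset.univ ∧ blockCount n A = n - A.card

/-- `A` is an almost thick subset of the cyclic set `N = ℤ/nℤ`: `∅ ≠ A ⊊ N` and
`b(A) = n - |A| - 1`, equivalently exactly one gap of `A` has two elements and all other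
gaps are singletons. -/
def IsAlmostThick (n : ℕ) [NeZero n] (A : Finset (ZMod n)) : Prop :=
  A.Nonempty ∧ A ≠ Finset.univ ∧ blockCount n A = n - A.card - 1

/-- **Thick subsets.**  Let `n ≥ 2` and let `A` be a thick subset of the cyclic set
`N = {1, …, n} ≅ ℤ/nℤ`.  Then `⌊(n+1)/2⌋ ≤ |A| ≤ n - 1`.  Moreover, if `n` is even, the
only thick subsets of cardinality `n/2` are `A_od = {1, 3, …, n-1}` (the odd residues)
and `A_ev = {2, 4, …, n}` (the even residues). -/
theorem thick_card_bounds (n : ℕ) [NeZero n] (hn : 2 ≤ n) (A : Finset (ZMod n))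
    (hA : IsThick n A) :
    ((n + 1) / 2 ≤ A.card ∧ A.card ≤ n - 1) ∧
    (Even n → A.card = n / 2 →
      A = Finset.univ.filter (fun k : ZMod n => k.val % 2 = 1) ∨
      A = Finset.univ.filter (fun k : ZMod n => k.val % 2 = 0)) := by
  obtain ⟨hne, huniv, hb⟩ := hA
  have hlt : A.card < n := by
    have h := Finset.card_lt_card (Finset.ssubset_univ_iff.mpr huniv)
    rwa [Finset.card_univ, ZMod.card] at h
  have hle : blockCount n A ≤ A.card := Finset.card_filter_le _ _
  refine ⟨⟨by omega, by omega⟩, ?_⟩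
  intro hev hc
  obtain ⟨m, hm⟩ := hev
  have hfil : (A.filter fun k => k - 1 ∉ A) = A := by
    apply Finset.eq_of_subset_of_card_le (Finset.filter_subset _ _)
    unfold blockCount at hb
    omega
  have h1 : ∀ k ∈ A, k - 1 ∉ A := fun k hk => by
    rw [← hfil] at hk
    exact (Finset.mem_filter.mp hk).2
  have himg : A.image (fun k => k - 1) = Aᶜ := by
    apply Finset.eq_of_subset_of_card_le
    · intro x hx
      obtain ⟨k, hk, rfl⟩ := Finset.mem_image.mp hx
      exact Finset.mem_compl.mpr (h1 k hk)
    · rw [Finset.card_image_of_injective _ (sub_left_injective), Finset.card_compl, ZMod.card]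
      omega
  have h2 : ∀ k, k ∉ A → k + 1 ∈ A := fun k hk => by
    have h : k ∈ A.image (fun k => k - 1) := by
      rw [himg]
      exact Finset.mem_compl.mpr hk
    obtain ⟨j, hj, rfl⟩ := Finset.mem_image.mp h
    simpa using hj
  have h3 : ∀ k, k + 1 ∈ A ↔ k ∉ A := fun k =>
    ⟨fun h => by simpa using h1 _ h, h2 k⟩
  have h4 : ∀ i : ℕ, ((i : ZMod n) ∈ A ↔ (i % 2 = 0 ↔ (0 : ZMod n) ∈ A)) := by
    intro i
    induction i with
    | zero => simp
    | succ i ih =>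
      rw [Nat.cast_succ, h3, ih]
      have : (i + 1) % 2 = 0 ↔ ¬ i % 2 = 0 := by omega
      tauto
  have h5 : ∀ k : ZMod n, (k ∈ A ↔ (k.val % 2 = 0 ↔ (0 : ZMod n) ∈ A)) := fun k => by
    have h := h4 k.val
    rwa [ZMod.natCast_zmod_val] at h
  by_cases h0 : (0 : ZMod n) ∈ A
  · right
    ext k
    rw [h5]
    simp [h0]
  · left
    ext k
    rw [h5]
    simp [h0]
end

section
/- Let n ≥ 2 and let B be an almost thick subset of N = {1, …, n}. Then there exists a sequence B_1, …, B_n of almost thick subsets of N, all of the same cardinality as B, with B_n = B, such that B_{(i+1) mod n}^{(1)} = B_i^{(2)} for every i ∈ N (indices taken cyclically in {1, …, n}), and such that the map N → N, i ↦ β₂(B_i), is a bijection. -/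
/-- Blocks are counted through the pairs of cyclically adjacent elements of the complement. -/
lemma blockCount_add_pairs (n : ℕ) [NeZero n] (A : Finset (ZMod n)) :
    blockCount n A + (Finset.univ.filter fun x => x ∉ A ∧ x + 1 ∉ A).card + A.card = n := by
  have h1 : blockCount n A = (Finset.univ.filter fun x => x ∉ A ∧ x + 1 ∈ A).card := by
    unfold blockCount
    refine Finset.card_bij' (fun x _ => x - 1) (fun x _ => x + 1) ?_ ?_ ?_ ?_
    · intro a ha
      simp only [Finset.mem_filter, Finset.mem_univ, true_and, sub_add_cancel] at ha ⊢
      exact ⟨ha.2, ha.1⟩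
    · intro a ha
      simp only [Finset.mem_filter, Finset.mem_univ, true_and, add_sub_cancel_right] at ha ⊢
      exact ⟨ha.2, ha.1⟩
    · intro a _; simp
    · intro a _; simp
  have h2 : (Finset.univ.filter fun x => x ∉ A ∧ x + 1 ∈ A).card
      + (Finset.univ.filter fun x => x ∉ A ∧ x + 1 ∉ A).card = (Aᶜ).card := by
    rw [← Finset.card_filter_add_card_filter_not (s := Aᶜ) (p := fun x => x + 1 ∈ A)]
    congr 2 <;> ext x <;> simp
  have h3 := Finset.card_add_card_compl A
  rw [ZMod.card] at h3
  omega

/-- Turning a key function into a ranking with values `1, …, n`. -/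
lemma exists_rank (n : ℕ) [NeZero n] (K : ZMod n → ℕ) (hK : Function.Injective K) :
    ∃ τ : ZMod n → ℕ, (∀ s, 1 ≤ τ s ∧ τ s ≤ n) ∧ Function.Injective τ ∧
      (∀ s t, K s < K t → τ s < τ t) ∧ (∀ s, (∀ t, K t ≤ K s) → τ s = n) := by
  have hm : ∀ s t, K s < K t → (Finset.univ.filter fun x => K x ≤ K s).card <
      (Finset.univ.filter fun x => K x ≤ K t).card := by
    intro s t h
    apply Finset.card_lt_card
    rw [Finset.ssubset_iff_of_subset]
    · exact ⟨t, by simp, by simpa using h⟩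
    · intro x hx
      simp only [Finset.mem_filter, Finset.mem_univ, true_and] at hx ⊢
      omega
  refine ⟨fun s => (Finset.univ.filter fun x => K x ≤ K s).card, ?_, ?_, hm, ?_⟩
  · intro s
    constructor
    · exact Finset.card_pos.mpr ⟨s, by simp⟩
    · exact (Finset.card_le_univ _).trans (ZMod.card n).le
  · intro s t h
    rcases lt_trichotomy (K s) (K t) with h' | h' | h'
    · exact absurd h (hm _ _ h').ne
    · exact hK h'
    · exact absurd h (hm _ _ h').ne'
  · intro s h
    simp only
    rw [Finset.filter_true_of_mem (fun x _ => h x)]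
    simp [ZMod.card]

/-- The departure schedule. -/
lemma exists_schedule (n : ℕ) [NeZero n] (hn : 3 ≤ n) (C : Finset (ZMod n)) (k : ZMod n)
    (hk : k ∈ C) (hk2 : k + 2 ∉ C) (hC : ∀ s ∈ C, s + 1 ∉ C) :
    ∃ τ : ZMod n → ℕ, (∀ s, 1 ≤ τ s ∧ τ s ≤ n) ∧ Function.Injective τ ∧ τ (k + 1) = n ∧
      (∀ s, s ∉ C → τ (s + 1) < τ s) ∧
      (∀ s, s ∈ C → τ s < τ (s + 1) ∧ τ s < τ (s + 2) ∧ τ (s - 1) < τ (s + 1)) := by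
  obtain ⟨w, hwlt, hwinj, hw0, hws⟩ : ∃ w : ZMod n → ℕ, (∀ s, w s < n) ∧
      Function.Injective w ∧ w (k + 1) = 0 ∧ (∀ s, s ≠ k → w (s + 1) = w s + 1) := by
    refine ⟨fun s => (s - (k + 1)).val, fun s => ZMod.val_lt _, ?_, by simp, ?_⟩
    · intro a b h
      exact sub_left_injective (ZMod.val_injective n h)
    · intro s hs
      have : s + 1 - (k + 1) = (s - (k + 1)) + 1 := by ring
      simp only [this]
      have h1 : (1 : ZMod n).val = 1 := by
        have : Fact (1 < n) := ⟨by omega⟩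
        exact ZMod.val_one n
      have hlt := ZMod.val_lt (s - (k + 1))
      by_cases h : (s - (k + 1)).val + 1 < n
      · rw [ZMod.val_add_of_lt (by omega), h1]
      · exfalso
        apply hs
        have h2 : (s - (k + 1)).val + 1 = n := by omega
        have h3 : (((s - (k + 1)).val + 1 : ℕ) : ZMod n) = 0 := by rw [h2]; simp
        push_cast at h3
        rw [ZMod.natCast_zmod_val] at h3
        linear_combination h3
  have hw1 : w (k + 2) = 1 := by
    have h1 : k + 1 ≠ k := fun h => hC k hk (by rw [h]; exact hk)
    have := hws (k + 1) h1
    rw [hw0] at this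
    rw [show k + 2 = k + 1 + 1 by ring]; exact this
  let r : ZMod n → ℕ := fun s => (C.filter fun c => w c < w s).card
  have hr : ∀ s, r s ≤ n := fun s => (Finset.card_le_univ _).trans (ZMod.card n).le
  have hr1 : ∀ s, s ∉ C → s ≠ k → r s = r (s + 1) := by
    intro s hs hsk
    simp only [r]
    congr 1
    apply Finset.filter_congr
    intro c hc
    rw [hws s hsk]
    have : w c ≠ w s := fun h => hs (hwinj h ▸ hc)
    omega
  have hr2 : ∀ s t, s ∈ C → w s < w t → r s < r t := by
    intro s t hs h
    apply Finset.card_lt_card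
    rw [Finset.ssubset_iff_of_subset]
    · exact ⟨s, by simp [hs, h], by simp⟩
    · intro x hx
      simp only [Finset.mem_filter] at hx ⊢
      exact ⟨hx.1, by omega⟩
  let M : ℕ := (n + 1) * (n + 1)
  let f : ZMod n → ℕ := fun s => if w s = 0 then M + n else
    if s - 1 ∈ C ∨ w s = 1 then M + w s else (n + 1) * r s + (n - w s)
  have f0 : ∀ s, w s = 0 → f s = M + n := fun s h => by simp [f, h]
  have fB : ∀ s, w s ≠ 0 → (s - 1 ∈ C ∨ w s = 1) → f s = M + w s := fun s h h' => by
    simp only [f]; rw [if_neg h, if_pos h']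
  have fA : ∀ s, w s ≠ 0 → ¬ (s - 1 ∈ C ∨ w s = 1) → f s = (n + 1) * r s + (n - w s) :=
    fun s h h' => by simp only [f]; rw [if_neg h, if_neg h']
  have fAlt : ∀ s, (n + 1) * r s + (n - w s) < M := by
    intro s
    have := Nat.mul_le_mul_left (n + 1) (hr s)
    simp only [M]
    have : (n + 1) * (n + 1) = (n + 1) * n + n + 1 := by ring
    omega
  have eq0 : ∀ s, w s = 0 → s = k + 1 := fun s h => hwinj (h.trans hw0.symm)
  have eq1 : ∀ s, w s = 1 → s = k + 2 := fun s h => hwinj (h.trans hw1.symm)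
  have hk1 : k + 1 ∉ C := hC k hk
  have hpred : ∀ s ∈ C, s - 1 ∉ C := fun s hs h => hC _ h (by simpa using hs)
  have hCA : ∀ s ∈ C, w s ≠ 0 ∧ ¬ (s - 1 ∈ C ∨ w s = 1) := by
    intro s hs
    refine ⟨fun h => hk1 (eq0 s h ▸ hs), ?_⟩
    rintro (h | h)
    · exact hpred s hs h
    · exact hk2 (eq1 s h ▸ hs)
  have fmax : ∀ s, w s ≠ 0 → f s < M + n := by
    intro s h
    have := hwlt s
    have := fAlt s
    by_cases h' : s - 1 ∈ C ∨ w s = 1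
    · rw [fB s h h']; omega
    · rw [fA s h h']; omega
  -- first family of constraints
  have c1 : ∀ s, s ∉ C → f (s + 1) < f s := by
    intro s hs
    have hsk : s ≠ k := fun h => hs (h ▸ hk)
    have hw' := hws s hsk
    by_cases h0 : w s = 0
    · rw [f0 s h0]
      exact fmax _ (by omega)
    · have hA' : ¬ (s + 1 - 1 ∈ C ∨ w (s + 1) = 1) := by
        rw [add_sub_cancel_right]
        rintro (h | h)
        · exact hs h
        · omega
      rw [fA (s + 1) (by omega) hA']
      have := fAlt (s + 1)
      have := hwlt (s + 1)
      by_cases h' : s - 1 ∈ C ∨ w s = 1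
      · rw [fB s h0 h']; omega
      · rw [fA s h0 h', ← hr1 s hs hsk]; omega
  have c2 : ∀ s, s ∈ C → f s < f (s + 1) ∧ f s < f (s + 2) ∧ f (s - 1) < f (s + 1) := by
    intro s hs
    obtain ⟨a1, a2⟩ := hCA s hs
    have hfs := fA s a1 a2
    have hlt := fAlt s
    have hw2 : 2 ≤ w s := by
      have : w s ≠ 1 := fun h => a2 (Or.inr h)
      omega
    have hs1 : w s = w (s - 1) + 1 := by
      have := hws (s - 1) (fun h => hpred s hs (h ▸ hk))
      simpa using this
    by_cases hsk : s = k
    · subst hsk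
      rw [f0 (s + 1) hw0, fB (s + 2) (by omega) (Or.inr hw1)]
      refine ⟨by omega, by omega, fmax _ (by omega)⟩
    · have hw' := hws s hsk
      have hw'' := hws (s + 1) (fun h => hC s hs (h ▸ hk))
      rw [show s + 1 + 1 = s + 2 by ring] at hw''
      have hB : f (s + 1) = M + w (s + 1) :=
        fB (s + 1) (by omega) (Or.inl (by simpa using hs))
      have hA2 : f (s + 2) = (n + 1) * r (s + 2) + (n - w (s + 2)) := by
        apply fA _ (by omega)
        rintro (h | h)
        · exact hC s hs (by rwa [show s + 2 - 1 = s + 1 by ring] at h)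
        · omega
      refine ⟨by omega, ?_, ?_⟩
      · rw [hfs, hA2]
        have h1 := hr2 s (s + 2) hs (by omega)
        have h2 : (n + 1) * (r s + 1) ≤ (n + 1) * r (s + 2) := Nat.mul_le_mul_left _ h1
        have h3 : (n + 1) * (r s + 1) = (n + 1) * r s + n + 1 := by ring
        omega
      · rw [hB]
        have := fAlt (s - 1)
        by_cases h' : s - 1 - 1 ∈ C ∨ w (s - 1) = 1
        · rw [fB (s - 1) (by omega) h']; omega
        · rw [fA (s - 1) (by omega) h']; omega
  have hKlt : ∀ s t, f s < f t → n * f s + w s < n * f t + w t := by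
    intro s t h
    have h1 : n * (f s + 1) ≤ n * f t := Nat.mul_le_mul_left _ h
    have h2 : n * (f s + 1) = n * f s + n := by ring
    have := hwlt s
    omega
  have hKinj : Function.Injective (fun s => n * f s + w s) := by
    intro s t h
    simp only at h
    rcases lt_trichotomy (f s) (f t) with h' | h' | h'
    · have := hKlt _ _ h'; omega
    · rw [h'] at h; exact hwinj (by omega)
    · have := hKlt _ _ h'; omega
  obtain ⟨τ, t1, t2, t3, t4⟩ := exists_rank n (fun s => n * f s + w s) hKinj
  refine ⟨τ, t1, t2, t4 _ ?_, fun s hs => t3 _ _ (hKlt _ _ (c1 s hs)), fun s hs => ?_⟩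
  · intro t
    by_cases h : w t = 0
    · rw [eq0 t h]
    · exact (hKlt _ _ (by rw [f0 (k + 1) hw0]; exact fmax t h)).le
  · obtain ⟨x, y, z⟩ := c2 s hs
    exact ⟨t3 _ _ (hKlt _ _ x), t3 _ _ (hKlt _ _ y), t3 _ _ (hKlt _ _ z)⟩

/-- **Claim 1.**  Let `n ≥ 2` and let `B` be an almost thick subset of the cyclic set
`N = {1, …, n} ≅ ℤ/nℤ`.  Then there is a sequence `B_1, …, B_n` (indexed cyclically by
`i : ℤ/nℤ`, with `B_n = B_0 = B`) of almost thick subsets, all of the same cardinality as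
`B`, such that `B_{i+1}^{(1)} = B_i^{(2)}` for every `i`, and the map `i ↦ β₂(B_i)` is a
bijection of `N`.  Here the two-element gap of `B_i` is `{g i, g i + 1}` (so
`β₁(B_i) = g i`, `β₂(B_i) = g i + 1`, `B_i^{(1)} = B_i ∪ {g i}` and
`B_i^{(2)} = B_i ∪ {g i + 1}`). -/
theorem almost_thick_cyclic_sequence (n : ℕ) [NeZero n] (hn : 2 ≤ n)
    (B : Finset (ZMod n)) (hB : IsAlmostThick n B) :
    ∃ (Bs : ZMod n → Finset (ZMod n)) (g : ZMod n → ZMod n),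
      Bs 0 = B ∧
      (∀ i, IsAlmostThick n (Bs i)) ∧
      (∀ i, (Bs i).card = B.card) ∧
      (∀ i, g i ∉ Bs i ∧ g i + 1 ∉ Bs i) ∧
      (∀ i, insert (g (i + 1)) (Bs (i + 1)) = insert (g i + 1) (Bs i)) ∧
      Function.Bijective (fun i => g i + 1) := by
  obtain ⟨hne, hnu, hbc⟩ := hB
  have hpairs := blockCount_add_pairs n B
  have hcard : B.card < n := by
    have := (Finset.card_lt_iff_ne_univ B).mpr hnu
    rwa [ZMod.card] at this
  have hone : (Finset.univ.filter fun x => x ∉ B ∧ x + 1 ∉ B).card = 1 := by omega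
  obtain ⟨k, hk⟩ := Finset.card_eq_one.mp hone
  have hkB : ∀ x, (x ∉ B ∧ x + 1 ∉ B) ↔ x = k := by
    intro x
    have := Finset.ext_iff.mp hk x
    simpa using this
  obtain ⟨k0, k1⟩ := (hkB k).mpr rfl
  have h10 : (1 : ZMod n) ≠ 0 := by
    have : Fact (1 < n) := ⟨by omega⟩
    exact one_ne_zero
  have hk1k : k + 1 ≠ k := by simpa using h10
  have hn3 : 3 ≤ n := by
    obtain ⟨b, hb⟩ := hne
    have h3 : ({k, k + 1, b} : Finset (ZMod n)).card = 3 := by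
      apply Finset.card_eq_three.mpr
      exact ⟨k, k + 1, b, hk1k.symm, fun h => k0 (h ▸ hb), fun h => k1 (h ▸ hb), rfl⟩
    have := Finset.card_le_univ ({k, k + 1, b} : Finset (ZMod n))
    rw [ZMod.card] at this
    omega
  let C : Finset (ZMod n) := Finset.univ.filter fun x => x ∉ B ∧ x ≠ k + 1
  have memC : ∀ x, x ∈ C ↔ (x ∉ B ∧ x ≠ k + 1) := fun x => by simp [C]
  obtain ⟨τ, t1, tinj, tk, c1, c2⟩ := exists_schedule n hn3 C k
    ((memC k).mpr ⟨k0, hk1k.symm⟩)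
    (fun h => hk1k ((hkB (k + 1)).mp ⟨k1, by
      rw [show k + 1 + 1 = k + 2 by ring]; exact ((memC _).mp h).1⟩))
    (fun s hs h => by
      rw [memC] at hs h
      have := (hkB s).mp ⟨hs.1, h.1⟩
      exact h.2 (by rw [this]))
  have hC : ∀ s ∈ C, s + 1 ∉ C := by
    intro s hs h
    have h1 := (c2 s hs).1
    rw [memC] at hs h
    have := (hkB s).mp ⟨hs.1, h.1⟩
    exact h.2 (by rw [this])
  let j : ZMod n → ℕ := fun i => if i = 0 then n else i.val
  have hj0 : j 0 = n := by simp [j]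
  have hjr : ∀ i, 1 ≤ j i ∧ j i ≤ n := by
    intro i
    simp only [j]
    split_ifs with h
    · omega
    · have := ZMod.val_lt i
      have := (ZMod.val_ne_zero i).mpr h
      omega
  have hjc : ∀ i, ((j i : ℕ) : ZMod n) = i := by
    intro i
    simp only [j]
    split_ifs with h
    · simp [h]
    · simp
  have huniq : ∀ a b : ℕ, 1 ≤ a → a ≤ n → 1 ≤ b → b ≤ n → ((a : ℕ) : ZMod n) = b → a = b := by
    intro a b ha ha' hb hb' h
    rw [ZMod.natCast_eq_natCast_iff] at h
    have h2 : (a - 1) ≡ (b - 1) [MOD n] := by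
      apply Nat.ModEq.add_right_cancel' 1
      rwa [Nat.sub_add_cancel ha, Nat.sub_add_cancel hb]
    have := Nat.ModEq.eq_of_lt_of_lt h2 (by omega) (by omega)
    omega
  have hjs : ∀ i, j (i + 1) = if j i = n then 1 else j i + 1 := by
    intro i
    obtain ⟨a, b⟩ := hjr i
    apply huniq _ _ (hjr _).1 (hjr _).2
    · split_ifs <;> omega
    · split_ifs <;> omega
    · rw [hjc]
      split_ifs with h
      · have := hjc i
        rw [h] at this
        rw [← this]; simp
      · push_cast; rw [hjc]
  have hbij : Function.Bijective (fun s => ((τ s : ℕ) : ZMod n)) := by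
    apply Finite.injective_iff_bijective.mp
    intro s t h
    exact tinj (huniq _ _ (t1 s).1 (t1 s).2 (t1 t).1 (t1 t).2 h)
  let E := Equiv.ofBijective _ hbij
  let σ : ZMod n → ZMod n := E.symm
  have hσ : ∀ i, τ (σ i) = j i := by
    intro i
    apply huniq _ _ (t1 _).1 (t1 _).2 (hjr i).1 (hjr i).2
    rw [hjc]
    exact E.apply_symm_apply i
  have hσ' : ∀ i s, s = σ i ↔ τ s = j i := by
    intro i s
    rw [← hσ i]
    exact tinj.eq_iff.symm
  have hg' : ∀ i s, s = σ i - 1 ↔ τ (s + 1) = j i := by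
    intro i s
    rw [← hσ' i, eq_sub_iff_add_eq]
  let D : ZMod n → ZMod n → Prop := fun i s =>
    (s ∈ C ∧ (j i ≤ τ s ∨ τ (s + 1) ≤ j i)) ∨ (s ∉ C ∧ τ (s + 1) ≤ j i ∧ j i ≤ τ s)
  classical
  let Bs : ZMod n → Finset (ZMod n) := fun i => Finset.univ.filter fun s => ¬ D i s
  have memBs : ∀ i s, s ∈ Bs i ↔ ¬ D i s := fun i s => by simp [Bs]
  have hDg : ∀ i, D i (σ i - 1) := by
    intro i
    have h : τ (σ i - 1 + 1) = j i := (hg' i _).mp rfl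
    by_cases hc : σ i - 1 ∈ C
    · exact Or.inl ⟨hc, Or.inr h.le⟩
    · have := c1 _ hc
      exact Or.inr ⟨hc, h.le, by omega⟩
  have hDs : ∀ i, D i (σ i) := by
    intro i
    have h := hσ i
    by_cases hc : σ i ∈ C
    · exact Or.inl ⟨hc, Or.inl h.ge⟩
    · have := c1 _ hc
      exact Or.inr ⟨hc, by omega, h.ge⟩
  have hgB : ∀ i, σ i - 1 ∉ Bs i := fun i h => (memBs _ _).mp h (hDg i)
  have hsB : ∀ i, σ i ∉ Bs i := fun i h => (memBs _ _).mp h (hDs i)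
  have hB0 : Bs 0 = B := by
    ext s
    rw [memBs]
    simp only [D, hj0]
    have a := t1 s
    have b := t1 (s + 1)
    have e : τ s = n ↔ s = k + 1 :=
      ⟨fun h => tinj (h.trans tk.symm), fun h => by rw [h]; exact tk⟩
    by_cases hc : s ∈ C
    · have h1 := ((memC s).mp hc).1
      simp [hc, h1, b.2]
    · have h1 : s ∈ B ∨ s = k + 1 := by
        by_contra hcon
        push Not at hcon
        exact hc ((memC s).mpr hcon)
      simp only [hc, false_and, not_false_eq_true, true_and, false_or, b.2, not_le]
      constructor
      · intro h
        rcases h1 with h1 | h1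
        · exact h1
        · have := e.mpr h1; omega
      · intro h
        have : s ≠ k + 1 := fun h' => k1 (h' ▸ h)
        have : τ s ≠ n := fun h' => this (e.mp h')
        omega
  have hins : ∀ i, insert (σ (i + 1) - 1) (Bs (i + 1)) = insert (σ i) (Bs i) := by
    intro i
    ext s
    rw [Finset.mem_insert, Finset.mem_insert, hg', hσ', memBs, memBs]
    simp only [D]
    have hj1 := hjs i
    have a := t1 s
    have b := t1 (s + 1)
    have := hjr i
    by_cases hc : s ∈ C
    · have := (c2 s hc).1
      simp only [hc, true_and, not_true_eq_false, false_and, or_false]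
      split_ifs at hj1 <;> omega
    · have := c1 s hc
      simp only [hc, false_and, not_false_eq_true, true_and, false_or]
      split_ifs at hj1 <;> omega
  have hcs : ∀ i, (Bs (i + 1)).card = (Bs i).card := by
    intro i
    have := congrArg Finset.card (hins i)
    rw [Finset.card_insert_of_notMem (hgB _), Finset.card_insert_of_notMem (hsB _)] at this
    omega
  have hcn : ∀ m : ℕ, (Bs (m : ZMod n)).card = B.card := by
    intro m
    induction m with
    | zero => rw [Nat.cast_zero, hB0]
    | succ m ih => rw [Nat.cast_succ, hcs, ih]
  have hcc : ∀ i, (Bs i).card = B.card := by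
    intro i
    have := hcn (j i)
    rwa [hjc] at this
  have hpair : ∀ i x, D i x → D i (x + 1) → x = σ i - 1 := by
    intro i x h h'
    rw [hg']
    simp only [D] at h h'
    rw [show x + 1 + 1 = x + 2 by ring] at h'
    by_cases hc : x ∈ C
    · have hc' := hC x hc
      have := c2 x hc
      simp only [hc, hc', true_and, not_true_eq_false, not_false_eq_true, false_and, or_false,
        false_or] at h h'
      omega
    · by_cases hc' : x + 1 ∈ C
      · have := (c2 _ hc').2.2
        rw [add_sub_cancel_right, show x + 1 + 1 = x + 2 by ring] at this
        simp only [hc, hc', true_and, not_true_eq_false, not_false_eq_true, false_and, or_false,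
          false_or] at h h'
        omega
      · simp only [hc, hc', true_and, not_false_eq_true, false_and, false_or] at h h'
        omega
  refine ⟨Bs, fun i => σ i - 1, hB0, ?_, hcc, ?_, ?_, ?_⟩
  · intro i
    refine ⟨?_, ?_, ?_⟩
    · rw [← Finset.card_pos, hcc]
      exact Finset.card_pos.mpr hne
    · intro h
      exact hgB i (h ▸ Finset.mem_univ _)
    · have h1 := blockCount_add_pairs n (Bs i)
      have h2 : (Finset.univ.filter fun x => x ∉ Bs i ∧ x + 1 ∉ Bs i) = {σ i - 1} := by
        ext x
        simp only [Finset.mem_filter, Finset.mem_univ, true_and, Finset.mem_singleton]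
        constructor
        · rintro ⟨h, h'⟩
          rw [memBs, not_not] at h h'
          exact hpair i x h h'
        · rintro rfl
          exact ⟨hgB i, by rw [sub_add_cancel]; exact hsB i⟩
      rw [h2, Finset.card_singleton] at h1
      omega
  · intro i
    exact ⟨hgB i, by rw [sub_add_cancel]; exact hsB i⟩
  · intro i
    simp only [sub_add_cancel]
    exact hins i
  · simp only [sub_add_cancel]
    exact E.symm.bijective
end

section
/- Let n ≥ 2 and a_1, …, a_n ∈ ℕ, with indices taken cyclically in {1, …, n}. Set d := ∏_{j=1}^n a_j − (−1)^n and, for j ∈ {1, …, n}, v_j := Σ_{l=1}^n (−1)^{l−1} ∏_{k=j+l}^{j+n−1} a_{(k) mod n}, where the product for l = n is empty and equals 1. Then a_j · v_j + v_{(j+1) mod n} = d for every j ∈ {1, …, n}. -/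
/-- `d = a_1 ⋯ a_n - (-1)^n` for exponents `a : ZMod n → ℕ` (indices cyclic in
`{1, …, n} ≅ ℤ/nℤ`). -/
def cycD (n : ℕ) [NeZero n] (a : ZMod n → ℕ) : ℤ :=
  (∏ j : ZMod n, (a j : ℤ)) - (-1) ^ n

/-- `v_j = Σ_{l=1}^n (-1)^{l-1} ∏_{k=j+l}^{j+n-1} a_k` (the product for `l = n` is empty
and equals `1`); here the sum is reindexed by `l' = l - 1 ∈ {0, …, n-1}` and the product
by `t ∈ {0, …, n-1-l'-1}` with `k = j + l' + 1 + t`, indices taken cyclically. -/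
def cycV (n : ℕ) [NeZero n] (a : ZMod n → ℕ) (j : ZMod n) : ℤ :=
  ∑ l ∈ Finset.range n, (-1 : ℤ) ^ l *
    ∏ t ∈ Finset.range (n - 1 - l), (a (j + ((l + 1 + t : ℕ) : ZMod n)) : ℤ)

/-- **The weight system identity.**  Let `n ≥ 2` and `a_1, …, a_n ∈ ℕ` with cyclic
indices.  With `d := ∏ a_j - (-1)^n` and `v_j` as above, one has
`a_j · v_j + v_{j+1} = d` for every `j`. -/
theorem cycle_weight_identity (n : ℕ) [NeZero n] (hn : 2 ≤ n) (a : ZMod n → ℕ)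
    (ha : ∀ j, 0 < a j) :
    ∀ j : ZMod n, (a j : ℤ) * cycV n a j + cycV n a (j + 1) = cycD n a := by
  intro j
  set Q : ℕ → ℤ := fun l =>
    ∏ t ∈ Finset.range (n - l), (a (j + ((l + 1 + t : ℕ) : ZMod n)) : ℤ) with hQ
  have h1 : (a j : ℤ) * cycV n a j = ∑ l ∈ Finset.range n, (-1 : ℤ) ^ l * Q l := by
    unfold cycV
    rw [Finset.mul_sum]
    refine Finset.sum_congr rfl fun l hl => ?_
    have hl' := Finset.mem_range.mp hl
    have e : n - l = (n - 1 - l) + 1 := by omega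
    have e2 : l + 1 + (n - 1 - l) = n := by omega
    simp only [hQ]
    rw [e, Finset.prod_range_succ, e2, ZMod.natCast_self, add_zero]
    ring
  have h2 : cycV n a (j + 1) = ∑ l ∈ Finset.range n, (-1 : ℤ) ^ l * Q (l + 1) := by
    unfold cycV
    refine Finset.sum_congr rfl fun l hl => ?_
    have e : n - (l + 1) = n - 1 - l := by omega
    simp only [hQ]
    rw [e]
    congr 1
    refine Finset.prod_congr rfl fun t _ => ?_
    congr 2
    push_cast
    ring
  have h3 : Q 0 = ∏ i : ZMod n, (a i : ℤ) := by
    simp only [hQ]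
    rw [Nat.sub_zero]
    refine Finset.prod_bij (fun t _ => j + ((0 + 1 + t : ℕ) : ZMod n)) ?_ ?_ ?_ ?_
    · intros; exact Finset.mem_univ _
    · intro t ht s hs h
      rw [Finset.mem_range] at ht hs
      push_cast at h
      have h' : (t : ZMod n) = (s : ZMod n) := add_left_cancel (add_left_cancel h)
      rw [ZMod.natCast_eq_natCast_iff'] at h'
      rwa [Nat.mod_eq_of_lt ht, Nat.mod_eq_of_lt hs] at h'
    · intro b _
      refine ⟨(b - j - 1).val, Finset.mem_range.mpr (ZMod.val_lt _), ?_⟩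
      push_cast
      rw [ZMod.natCast_zmod_val]
      ring
    · intros; rfl
  have h4 : Q n = 1 := by simp [hQ]
  rw [h1, h2, ← Finset.sum_add_distrib, cycD, ← h3]
  have h5 := Finset.sum_range_sub' (fun l => (-1 : ℤ) ^ l * Q l) n
  simp only [h4, pow_zero, one_mul, mul_one] at h5
  rw [← h5]
  refine Finset.sum_congr rfl fun l _ => ?_
  ring
end

section
/- Let n ≥ 2 and a_1, …, a_n ∈ ℕ, with indices taken cyclically in {1, …, n}. Set d := ∏_{j=1}^n a_j − (−1)^n and, for j ∈ {1, …, n}, v_j := Σ_{l=1}^n (−1)^{l−1} ∏_{k=j+l}^{j+n−1} a_{(k) mod n}, where the product for l = n is empty and equals 1. Then gcd(v_j, d) = gcd(v_1, d) for every j ∈ {1, …, n}. -/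
theorem cyc_prod_shift (m : ℕ) (a : ZMod (m + 1) → ℕ) (j : ZMod (m + 1)) :
    ∏ t ∈ Finset.range (m + 1), (a (j + ((t : ℕ) : ZMod (m + 1))) : ℤ)
      = ∏ i : ZMod (m + 1), (a i : ℤ) := by
  rw [← Equiv.prod_comp (Equiv.addLeft j) (fun i => (a i : ℤ)), Finset.prod_range]
  refine Finset.prod_congr rfl fun i _ => ?_
  have h : ((i : ℕ) : ZMod (m + 1)) = (i : ZMod (m + 1)) := by
    exact Fin.cast_val_eq_self i
  simp only [Equiv.coe_addLeft]
  rw [h]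

theorem cyc_rec (n : ℕ) [NeZero n] (a : ZMod n → ℕ) (j : ZMod n) :
    cycV n a (j + 1) = cycD n a - a j * cycV n a j := by
  obtain ⟨m, rfl⟩ : ∃ m, n = m + 1 := ⟨n - 1, by have := NeZero.pos n; omega⟩
  have hP := cyc_prod_shift m a j
  rw [Finset.prod_range_succ'] at hP
  unfold cycV cycD
  rw [← hP, Finset.sum_range_succ, Finset.sum_range_succ' _ m, mul_add, Finset.mul_sum]
  have key : ∀ l ∈ Finset.range m,
      (-1 : ℤ) ^ l * ∏ t ∈ Finset.range (m + 1 - 1 - l),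
        (a (j + 1 + ((l + 1 + t : ℕ) : ZMod (m + 1))) : ℤ)
      = - ((a j : ℤ) * ((-1 : ℤ) ^ (l + 1) * ∏ t ∈ Finset.range (m + 1 - 1 - (l + 1)),
        (a (j + ((l + 1 + 1 + t : ℕ) : ZMod (m + 1))) : ℤ))) := by
    intro l hl
    have hl' := Finset.mem_range.mp hl
    obtain ⟨k, rfl⟩ : ∃ k, m = l + 1 + k := ⟨m - (l + 1), by omega⟩
    have e1 : l + 1 + k + 1 - 1 - l = k + 1 := by omega
    have e2 : l + 1 + k + 1 - 1 - (l + 1) = k := by omega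
    rw [e1, e2, Finset.prod_range_succ]
    have e3 : j + 1 + ((l + 1 + k : ℕ) : ZMod (l + 1 + k + 1)) = j := by
      have := ZMod.natCast_self (l + 1 + k + 1)
      rw [Nat.cast_succ] at this
      linear_combination this
    have e4 : ∏ t ∈ Finset.range k,
        (a (j + 1 + ((l + 1 + t : ℕ) : ZMod (l + 1 + k + 1))) : ℤ)
        = ∏ t ∈ Finset.range k, (a (j + ((l + 1 + 1 + t : ℕ) : ZMod (l + 1 + k + 1))) : ℤ) := by
      refine Finset.prod_congr rfl fun t _ => ?_
      congr 2
      push_cast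
      ring
    rw [e3, e4]
    ring
  rw [Finset.sum_congr rfl key, Finset.sum_neg_distrib]
  have e5 : ∏ t ∈ Finset.range (m + 1 - 1 - 0), (a (j + ((0 + 1 + t : ℕ) : ZMod (m + 1))) : ℤ)
      = ∏ t ∈ Finset.range m, (a (j + ((t + 1 : ℕ) : ZMod (m + 1))) : ℤ) := by
    refine Finset.prod_congr (by simp) fun t _ => ?_
    rw [show 0 + 1 + t = t + 1 by omega]
  rw [e5]
  simp only [Nat.add_sub_cancel, Nat.sub_self, Finset.range_zero, Finset.prod_empty,
    Nat.cast_zero, add_zero]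
  ring

theorem cyc_dvd_add (n : ℕ) [NeZero n] (a : ZMod n → ℕ) (j : ZMod n) (k : ℕ) :
    Int.gcd (cycV n a j) (cycD n a) ∣ Int.gcd (cycV n a (j + (k : ZMod n))) (cycD n a) := by
  induction k with
  | zero => simp
  | succ k ih =>
    refine ih.trans ?_
    rw [Nat.cast_succ, ← add_assoc, cyc_rec]
    refine Int.dvd_gcd ?_ (Int.gcd_dvd_right ..)
    exact dvd_sub (Int.gcd_dvd_right ..) ((Int.gcd_dvd_left ..).mul_left _)

theorem cyc_dvd (n : ℕ) [NeZero n] (a : ZMod n → ℕ) (i j : ZMod n) :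
    Int.gcd (cycV n a j) (cycD n a) ∣ Int.gcd (cycV n a i) (cycD n a) := by
  have h := cyc_dvd_add n a j (i - j).val
  rwa [ZMod.natCast_zmod_val, add_sub_cancel] at h

/-- **Equality of the gcds.**  Let `n ≥ 2` and `a_1, …, a_n ∈ ℕ` with cyclic indices.
With `d := ∏ a_j - (-1)^n` and `v_j` as above, `gcd(v_j, d) = gcd(v_1, d)` for all `j`. -/
theorem cycle_weight_gcd_constant (n : ℕ) [NeZero n] (hn : 2 ≤ n) (a : ZMod n → ℕ)
    (ha : ∀ j, 0 < a j) :
    ∀ j : ZMod n, Int.gcd (cycV n a j) (cycD n a) = Int.gcd (cycV n a 1) (cycD n a) := by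
  intro j
  exact Nat.dvd_antisymm (cyc_dvd n a 1 j) (cyc_dvd n a j 1)
end

section
/- Let n ≥ 2 and a_1, …, a_n ∈ ℕ, and let f ∈ ℂ[x_1, …, x_n] be the cycle type polynomial f = x_1^{a_1} x_2 + x_2^{a_2} x_3 + … + x_{n−1}^{a_{n−1}} x_n + x_n^{a_n} x_1. Assume that if n is even then it is not the case that a_j = 1 for all even j, and it is not the case that a_j = 1 for all odd j. Then the partial derivatives ∂f/∂x_1, …, ∂f/∂x_n vanish simultaneously only at the point 0 ∈ ℂ^n; i.e. f is an isolated quasihomogeneous singularity. -/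
theorem cyc_pderiv_eval (n : ℕ) [NeZero n] (a : Fin n → ℕ) (z : Fin n → ℂ) (j : Fin n) :
    MvPolynomial.eval z
        (MvPolynomial.pderiv (j + 1)
          (∑ i : Fin n, MvPolynomial.X i ^ a i * MvPolynomial.X (i + 1) :
            MvPolynomial (Fin n) ℂ)) =
      (a (j + 1) : ℂ) * z (j + 1) ^ (a (j + 1) - 1) * z (j + 1 + 1) + z j ^ a j := by
  classical
  have h : ∀ i : Fin n, MvPolynomial.eval z (MvPolynomial.pderiv (j + 1)
      (MvPolynomial.X i ^ a i * MvPolynomial.X (i + 1) : MvPolynomial (Fin n) ℂ)) =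
      (if i = j + 1 then (a i : ℂ) * z i ^ (a i - 1) * z (i + 1) else 0) +
      (if i = j then z i ^ a i else 0) := by
    intro i
    have e : i + 1 = j + 1 ↔ i = j := add_left_inj 1
    rw [Derivation.leibniz, Derivation.leibniz_pow, MvPolynomial.pderiv_X, MvPolynomial.pderiv_X]
    simp only [Pi.single_apply, e]
    clear e
    split_ifs <;> simp <;> ring
  rw [map_sum, map_sum, Finset.sum_congr rfl (fun i _ => h i), Finset.sum_add_distrib]
  simp

theorem cyc_seq (n : ℕ) (hn : 2 ≤ n) (A : ℕ → ℕ) (Z : ℕ → ℂ) (hA : ∀ t, 0 < A t)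
    (pA : ∀ t s, A (t + n * s) = A t) (pZ : ∀ t, Z (t + n) = Z t)
    (hc : Even n → ¬ (∀ i < n, Even (i + 1) → A i = 1) ∧ ¬ (∀ i < n, Odd (i + 1) → A i = 1))
    (hE : ∀ t, (A (t + 1) : ℂ) * Z (t + 1) ^ (A (t + 1) - 1) * Z (t + 1 + 1) + Z t ^ A t = 0)
    (k : ℕ) : Z k = 0 := by
  have pA1 : ∀ t, A (t + n) = A t := fun t => by simpa using pA t 1
  obtain ⟨m, hm⟩ : ∃ m : ℕ → ℂ, ∀ t, m t = Z t ^ A t * Z (t + 1) := ⟨_, fun _ => rfl⟩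
  have hrec : ∀ t, m t = - (A (t + 1) * m (t + 1)) := by
    intro t
    have h := hE t
    have e : Z (t + 1) ^ A (t + 1) = Z (t + 1) ^ (A (t + 1) - 1) * Z (t + 1) := by
      rw [← pow_succ, Nat.sub_add_cancel (hA _)]
    rw [hm, hm, e]
    linear_combination Z (t + 1) * h
  have pm : ∀ t, m (t + n) = m t := by
    intro t
    rw [hm, hm, pZ, pA1, show t + n + 1 = t + 1 + n by ring, pZ]
  have hnorm : ∀ t, ‖m t‖ = A (t + 1) * ‖m (t + 1)‖ := by
    intro t
    rw [hrec t]; simp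
  have hanti : Antitone (fun t => ‖m t‖) := by
    apply antitone_nat_of_succ_le
    intro t
    rw [hnorm t]
    have : (1 : ℝ) ≤ A (t + 1) := by exact_mod_cast hA (t + 1)
    nlinarith [norm_nonneg (m (t + 1))]
  have hconst : ∀ t, ‖m (t + 1)‖ = ‖m t‖ := by
    intro t
    apply le_antisymm (hanti (Nat.le_succ t))
    have := hanti (show t + 1 ≤ t + n by omega)
    simpa [pm] using this
  have hm0 : ∀ t, m t = 0 := by
    intro t
    by_contra hne
    have hnz : ∀ s, ‖m (t + s)‖ = ‖m t‖ := by
      intro s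
      induction s with
      | zero => rfl
      | succ s ih => rw [← ih]; exact hconst (t + s)
    have hpos : 0 < ‖m t‖ := norm_pos_iff.mpr hne
    have hA1 : ∀ s, A (t + s + 1) = 1 := by
      intro s
      have h := hnorm (t + s)
      rw [hconst, hnz] at h
      have h' : (A (t + s + 1) : ℝ) = 1 := by
        apply mul_right_cancel₀ hpos.ne'
        linarith
      exact_mod_cast h'
    have hall : ∀ i, A i = 1 := by
      intro i
      rw [← pA i (t + 1)]
      obtain ⟨s, hs⟩ : ∃ s, i + n * (t + 1) = t + s + 1 :=
        ⟨i + n * (t + 1) - (t + 1), by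
          have : t + 1 ≤ n * (t + 1) := Nat.le_mul_of_pos_left _ (by omega)
          omega⟩
      rw [hs, hA1]
    rcases Nat.even_or_odd n with he | ho
    · exact (hc he).1 (fun i _ _ => hall i)
    · have hs : ∀ s, m (t + s) = (-1) ^ s * m t := by
        intro s
        induction s with
        | zero => simp
        | succ s ih =>
          have h := hrec (t + s)
          rw [hall, ih] at h
          rw [pow_succ, ← add_assoc]
          push_cast at h
          linear_combination h
      have h := hs n
      rw [pm, ho.neg_one_pow] at h
      exact hne (by linear_combination h / 2)
  by_contra hk
  have step : ∀ t, Z t ≠ 0 → Z (t + 1) = 0 ∧ A (t + 1) = 1 ∧ Z (t + 2) ≠ 0 := by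
    intro t ht
    have h1 : Z (t + 1) = 0 := by
      have h := hm0 t
      rw [hm] at h
      exact (mul_eq_zero.mp h).resolve_left (pow_ne_zero _ ht)
    have h := hE t
    have hA1 : A (t + 1) = 1 := by
      by_contra hne
      have : A (t + 1) - 1 ≠ 0 := by have := hA (t + 1); omega
      rw [h1, zero_pow this] at h
      exact pow_ne_zero (A t) ht (by simpa using h)
    refine ⟨h1, hA1, fun h2 => ?_⟩
    rw [show t + 1 + 1 = t + 2 from rfl, h2] at h
    exact pow_ne_zero (A t) ht (by simpa using h)
  have hit : ∀ s, Z (k + 2 * s) ≠ 0 := by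
    intro s
    induction s with
    | zero => exact hk
    | succ s ih => exact (step _ ih).2.2
  rcases Nat.even_or_odd n with he | ho
  · have key : ∀ i, Odd (i + k) → A i = 1 := by
      intro i hi
      rw [← pA i (k + 1)]
      have hle : k + 1 ≤ n * (k + 1) := Nat.le_mul_of_pos_left _ (by omega)
      obtain ⟨q, hq⟩ := he.mul_right (k + 1)
      obtain ⟨r, hr⟩ := hi
      obtain ⟨s, hs⟩ : ∃ s, i + n * (k + 1) = k + 2 * s + 1 :=
        ⟨(i + n * (k + 1) - (k + 1)) / 2, by omega⟩
      rw [hs]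
      exact (step _ (hit s)).2.1
    rcases Nat.even_or_odd k with hk' | hk'
    · refine (hc he).1 fun i _ hi => key i ?_
      rw [Nat.even_iff] at *; rw [Nat.odd_iff]; omega
    · refine (hc he).2 fun i _ hi => key i ?_
      rw [Nat.odd_iff] at *; omega
  · obtain ⟨s, hs⟩ := ho
    have h := (step _ (hit s)).1
    rw [show k + 2 * s + 1 = k + n by omega, pZ] at h
    exact hk h

/-- **Cycle type singularities are isolated.**  Let `n ≥ 2` and `a_1, …, a_n ∈ ℕ`, and let
`f = x_1^{a_1} x_2 + x_2^{a_2} x_3 + ⋯ + x_{n-1}^{a_{n-1}} x_n + x_n^{a_n} x_1` be the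
cycle type polynomial (here the variable `x_{i+1}` is indexed by `i : Fin n`, and the
successor index is taken cyclically).  Assume that if `n` is even then it is not the case
that `a_j = 1` for all even `j`, and not the case that `a_j = 1` for all odd `j`.  Then
the partial derivatives `∂f/∂x_1, …, ∂f/∂x_n` vanish simultaneously only at `0 ∈ ℂ^n`;
i.e. `f` is an isolated quasihomogeneous singularity. -/
theorem cycle_type_isolated_singularity (n : ℕ) [NeZero n] (hn : 2 ≤ n)
    (a : Fin n → ℕ) (ha : ∀ i, 0 < a i)
    (hcond : Even n →
      ¬ (∀ i : Fin n, Even ((i : ℕ) + 1) → a i = 1) ∧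
      ¬ (∀ i : Fin n, Odd ((i : ℕ) + 1) → a i = 1))
    (z : Fin n → ℂ)
    (hz : ∀ j : Fin n,
      MvPolynomial.eval z
        (MvPolynomial.pderiv j
          (∑ i : Fin n, MvPolynomial.X i ^ a i * MvPolynomial.X (i + 1) :
            MvPolynomial (Fin n) ℂ)) = 0) :
    z = 0 := by
  have hs : ∀ t, Fin.ofNat n (t + 1) = Fin.ofNat n t + 1 := by
    intro t
    apply Fin.ext
    simp [Fin.val_add]
  have hi : ∀ i : Fin n, Fin.ofNat n (i : ℕ) = i := by
    intro i
    apply Fin.ext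
    simp [Nat.mod_eq_of_lt i.isLt]
  have hp : ∀ t s, Fin.ofNat n (t + n * s) = Fin.ofNat n t := by
    intro t s
    apply Fin.ext
    simp
  funext i
  have := cyc_seq n hn (fun t => a (Fin.ofNat n t)) (fun t => z (Fin.ofNat n t))
    (fun t => ha _) (fun t s => by simp only [hp])
    (fun t => by have := hp t 1; rw [mul_one] at this; simp only [this]) ?_ ?_ i
  · simpa only [hi, Pi.zero_apply] using this
  · intro he
    refine ⟨fun h => (hcond he).1 fun i hi' => ?_, fun h => (hcond he).2 fun i hi' => ?_⟩
    · simpa only [hi] using h i i.isLt hi'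
    · simpa only [hi] using h i i.isLt hi'
  · intro t
    have := hz (Fin.ofNat n t + 1)
    rw [cyc_pderiv_eval] at this
    simpa only [hs] using this
end
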